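/- Let λ be a partition of n, let i ∈ {0,1}, let 𝐢 = (i₁,…,i_k) ∈ {0,1}^k be an alternating bit string, let j = (j₁,…,j_k) ∈ ℤ_{≥0}^k with j₁+⋯+j_k = n, let d = 𝐢^j ∈ {0,1}ⁿ, and let i* ∈ {0,1} be the parity of i + i₁ + 1. For a standard tableau T ∈ Tab^{(i)}(λ; d), let Σ(T) be the filling of λ obtained by replacing each label t of T by σ(t). Then Σ(T) is a chess tableau of shape λ, parity i*, and content j, and the resulting map Σ : Tab^{(i)}(λ; d) → Chess^{(i*)}_j(λ) is surjective. -/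

import Mathlib

/-! Statement 2: the map Σ, replacing each label t of a standard tableau in
Tab^{(i)}(λ; d) by σ(t), lands in Chess^{(i*)}_j(λ) and is surjective onto it,
where d = 𝐢^j and i* is the parity of i + i₁ + 1. -/

def IsPartition (l : ℕ → ℕ) : Prop :=
  (∀ m n : ℕ, m ≤ n → l n ≤ l m) ∧ ∃ N, ∀ n, N ≤ n → l n = 0

def boxes (l : ℕ → ℕ) : Set (ℕ × ℕ) := {b | b.2 < l b.1}

noncomputable def psize (l : ℕ → ℕ) : ℕ := ∑ᶠ s, l s

def boxParity (i s t : ℕ) : ℕ := (s + t + i) % 2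

/-- Standard tableau of shape `l` with `|λ| = n`: a bijective labelling of the
boxes by `{1,…,n}`, strictly increasing along rows and down columns. -/
def IsStandardTableau (l : ℕ → ℕ) (n : ℕ) (T : ℕ × ℕ → ℕ) : Prop :=
  Set.BijOn T (boxes l) (Set.Icc 1 n) ∧
  (∀ s t t' : ℕ, t < t' → (s, t') ∈ boxes l → T (s, t) < T (s, t')) ∧
  (∀ s s' t : ℕ, s < s' → (s', t) ∈ boxes l → T (s, t) < T (s', t))

/-- The set `Tab^{(i)}(λ; d)`: standard tableaux of shape `l` whose `i`-parity
is the bit string `d` (tableaux are normalised to be `0` off the diagram). -/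
def TabSet (l : ℕ → ℕ) (n i : ℕ) (d : ℕ → ℕ) : Set (ℕ × ℕ → ℕ) :=
  {T | IsStandardTableau l n T ∧ (∀ b ∉ boxes l, T b = 0) ∧
    ∀ b ∈ boxes l, boxParity i b.1 b.2 = d (T b)}

def IsChessTableau (l : ℕ → ℕ) (i k : ℕ) (j : ℕ → ℕ) (T : ℕ × ℕ → ℕ) : Prop :=
  (∀ b ∈ boxes l, 1 ≤ T b ∧ T b ≤ k) ∧
  (∀ t, 1 ≤ t → t ≤ k → {b ∈ boxes l | T b = t}.ncard = j t) ∧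
  (∀ s t t' : ℕ, t < t' → (s, t') ∈ boxes l → T (s, t) < T (s, t')) ∧
  (∀ s s' t : ℕ, s < s' → (s', t) ∈ boxes l → T (s, t) ≤ T (s', t)) ∧
  (∀ b ∈ boxes l, T b % 2 = boxParity i b.1 b.2)

/-- The set `Chess^{(i)}_j(λ)` (normalised to be `0` off the diagram). -/
def ChessSet (l : ℕ → ℕ) (i k : ℕ) (j : ℕ → ℕ) : Set (ℕ × ℕ → ℕ) :=
  {T | IsChessTableau l i k j T ∧ ∀ b ∉ boxes l, T b = 0}

/-- `σ(t) = min { s | j₁ + ⋯ + j_s ≥ t }`. -/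
noncomputable def sigmaOf (j : ℕ → ℕ) (t : ℕ) : ℕ :=
  sInf {s | t ≤ ∑ r ∈ Finset.Icc 1 s, j r}

/-- `(i₁,…,i_k)` is an alternating bit string. -/
def Alternating (k : ℕ) (ii : ℕ → ℕ) : Prop :=
  (∀ t, 1 ≤ t → t ≤ k → ii t ≤ 1) ∧ ∀ t, 1 ≤ t → t < k → ii (t + 1) = 1 - ii t

theorem boxes_finite {l : ℕ → ℕ} (hl : IsPartition l) : (boxes l).Finite := by
  obtain ⟨hmono, N, hN⟩ := hl
  refine (Finset.range N ×ˢ Finset.range (l 0)).finite_toSet.subset fun b hb => ?_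
  have hb : b.2 < l b.1 := hb
  have h0 := hmono 0 b.1 (Nat.zero_le _)
  have h1 : b.1 < N := by
    by_contra! h
    have := hN b.1 h
    omega
  simp only [Finset.coe_product, Finset.coe_range, Set.mem_prod, Set.mem_Iio]
  omega

theorem row_mem_boxes {l : ℕ → ℕ} {s t t' : ℕ} (h : t ≤ t') (hb : (s, t') ∈ boxes l) :
    (s, t) ∈ boxes l :=
  lt_of_le_of_lt h hb

theorem column_mem_boxes {l : ℕ → ℕ} (hl : IsPartition l) {s s' t : ℕ} (h : s ≤ s')
    (hb : (s', t) ∈ boxes l) : (s, t) ∈ boxes l :=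
  lt_of_lt_of_le hb (hl.1 s s' h)

theorem partial_sum_mono (j : ℕ → ℕ) : Monotone fun s => ∑ r ∈ Finset.Icc 1 s, j r :=
  fun _ _ h => Finset.sum_le_sum_of_subset (Finset.Icc_subset_Icc_right h)

theorem sigmaOf_zero (j : ℕ → ℕ) : sigmaOf j 0 = 0 :=
  Nat.sInf_eq_zero.mpr (Or.inl (Nat.zero_le _))

theorem sigmaOf_eq_succ_iff (j : ℕ → ℕ) (m t : ℕ) :
    sigmaOf j m = t + 1 ↔
      ∑ r ∈ Finset.Icc 1 t, j r < m ∧ m ≤ ∑ r ∈ Finset.Icc 1 (t + 1), j r := by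
  constructor
  · intro h
    refine ⟨?_, ?_⟩
    · by_contra! hle
      have : sigmaOf j m ≤ t := Nat.sInf_le hle
      omega
    · have hne := Nat.nonempty_of_sInf_eq_succ h
      have hmem := Nat.sInf_mem hne
      rw [show sInf _ = t + 1 from h] at hmem
      exact hmem
  · rintro ⟨hlt, hle⟩
    refine le_antisymm (Nat.sInf_le hle) (Nat.succ_le_of_lt ?_)
    by_contra! hs
    have hmem : m ≤ ∑ r ∈ Finset.Icc 1 (sigmaOf j m), j r :=
      Nat.sInf_mem (s := {s | m ≤ ∑ r ∈ Finset.Icc 1 s, j r}) ⟨t + 1, hle⟩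
    exact absurd (hmem.trans (partial_sum_mono j hs)) (by simpa using hlt)

theorem sigmaOf_mem_Icc {j : ℕ → ℕ} {k m : ℕ} (hm : 1 ≤ m)
    (hmk : m ≤ ∑ r ∈ Finset.Icc 1 k, j r) : 1 ≤ sigmaOf j m ∧ sigmaOf j m ≤ k := by
  refine ⟨Nat.one_le_iff_ne_zero.mpr fun h => ?_, Nat.sInf_le hmk⟩
  have hmem : m ≤ ∑ r ∈ Finset.Icc 1 (sigmaOf j m), j r :=
    Nat.sInf_mem (s := {s | m ≤ ∑ r ∈ Finset.Icc 1 s, j r}) ⟨k, hmk⟩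
  rw [h] at hmem
  simp at hmem
  omega

theorem sigmaOf_le_sigmaOf {j : ℕ → ℕ} {k m m' : ℕ} (h : m ≤ m')
    (hm' : m' ≤ ∑ r ∈ Finset.Icc 1 k, j r) : sigmaOf j m ≤ sigmaOf j m' :=
  Nat.sInf_le (h.trans
    (Nat.sInf_mem (s := {s | m' ≤ ∑ r ∈ Finset.Icc 1 s, j r}) ⟨k, hm'⟩))

theorem setOf_sigmaOf_eq_succ (j : ℕ → ℕ) (t : ℕ) :
    {m | sigmaOf j m = t + 1} =
      Finset.Ioc (∑ r ∈ Finset.Icc 1 t, j r) (∑ r ∈ Finset.Icc 1 (t + 1), j r) := by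
  ext m
  simp [sigmaOf_eq_succ_iff]

theorem Alternating.mod_two {k : ℕ} {ii : ℕ → ℕ} (h : Alternating k ii) {t : ℕ} (h1 : 1 ≤ t)
    (hk : t ≤ k) : (ii t + 1) % 2 = (ii 1 + t) % 2 := by
  induction t, h1 using Nat.le_induction with
  | base => rfl
  | succ t ht ih =>
    have := ih (by omega)
    have := h.1 t ht (by omega)
    have := h.2 t ht (by omega)
    omega

theorem Alternating.eq_boxParity_iff {k : ℕ} {ii : ℕ → ℕ} (h : Alternating k ii) {t : ℕ}
    (h1 : 1 ≤ t) (hk : t ≤ k) (i s c : ℕ) :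
    boxParity i s c = ii t ↔ t % 2 = boxParity ((i + ii 1 + 1) % 2) s c := by
  have := h.mod_two h1 hk
  have := h.1 t h1 hk
  unfold boxParity
  omega

/-- Consecutive boxes in a row have distinct parities, so a filling that is weakly increasing
along the row and determines the parity of a box is strictly increasing. -/
theorem row_strict_of_weak {l : ℕ → ℕ} {i : ℕ} {S : ℕ × ℕ → ℕ}
    (hweak : ∀ s t t' : ℕ, t ≤ t' → (s, t') ∈ boxes l → S (s, t) ≤ S (s, t'))
    (hpar : ∀ b ∈ boxes l, S b % 2 = boxParity i b.1 b.2)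
    (s t t' : ℕ) (htt : t < t') (hb : (s, t') ∈ boxes l) : S (s, t) < S (s, t') := by
  have hb₁ := row_mem_boxes (Nat.succ_le_of_lt htt) hb
  have h₀ := hpar _ (row_mem_boxes htt.le hb)
  have h₁ := hpar _ hb₁
  have := hweak s t (t + 1) (Nat.le_succ t) hb₁
  have := hweak s (t + 1) t' htt hb
  simp only [boxParity] at h₀ h₁
  simp only [Nat.succ_eq_add_one] at *
  omega

theorem sigmaOf_comp_mem_chessSet {l : ℕ → ℕ} {n i k : ℕ} {ii j d : ℕ → ℕ}
    (hii : Alternating k ii) (hjsum : ∑ t ∈ Finset.Icc 1 k, j t = n)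
    (hd : ∀ t, 1 ≤ t → t ≤ n → d t = ii (sigmaOf j t)) {T : ℕ × ℕ → ℕ}
    (hT : T ∈ TabSet l n i d) :
    (fun b => sigmaOf j (T b)) ∈ ChessSet l ((i + ii 1 + 1) % 2) k j := by
  obtain ⟨⟨hbij, hrow, hcol⟩, hzero, hpar⟩ := hT
  subst hjsum
  have hrange : ∀ b ∈ boxes l, 1 ≤ sigmaOf j (T b) ∧ sigmaOf j (T b) ≤ k := fun b hb =>
    sigmaOf_mem_Icc (hbij.mapsTo hb).1 (hbij.mapsTo hb).2
  have hparity : ∀ b ∈ boxes l,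
      sigmaOf j (T b) % 2 = boxParity ((i + ii 1 + 1) % 2) b.1 b.2 := fun b hb => by
    have h := hpar b hb
    rw [hd _ (hbij.mapsTo hb).1 (hbij.mapsTo hb).2] at h
    exact (hii.eq_boxParity_iff (hrange b hb).1 (hrange b hb).2 _ _ _).mp h
  refine ⟨⟨hrange, ?_, ?_, ?_, hparity⟩, fun b hb => ?_⟩
  · intro t ht htk
    obtain ⟨t, rfl⟩ := Nat.exists_eq_add_of_le' ht
    have himage : T '' {b ∈ boxes l | sigmaOf j (T b) = t + 1} = {m | sigmaOf j m = t + 1} := by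
      ext m
      constructor
      · rintro ⟨b, hb, rfl⟩
        exact hb.2
      · intro hm
        have hm' := (sigmaOf_eq_succ_iff j m t).mp hm
        obtain ⟨b, hb, rfl⟩ := hbij.surjOn
          ⟨Nat.one_le_of_lt hm'.1, hm'.2.trans (partial_sum_mono j htk)⟩
        exact ⟨b, ⟨hb, hm⟩, rfl⟩
    rw [← Set.InjOn.ncard_image (hbij.injOn.mono fun b hb => hb.1), himage,
      setOf_sigmaOf_eq_succ, Set.ncard_coe_finset, Nat.card_Ioc,
      Finset.sum_Icc_succ_top (by omega)]
    omega
  · refine row_strict_of_weak (fun s t t' htt hb => ?_) hparity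
    rcases htt.eq_or_lt with rfl | htt
    · exact le_rfl
    · exact sigmaOf_le_sigmaOf (hrow s t t' htt hb).le (hbij.mapsTo hb).2
  · exact fun s s' t hss hb => sigmaOf_le_sigmaOf (hcol s s' t hss hb).le (hbij.mapsTo hb).2
  · simp only [hzero b hb, sigmaOf_zero]

section Standardization

variable {α β : Type*} [LinearOrder β] (F : Finset α) (key : α → β)

/-- The position of `a` when the elements of `F` are listed by increasing `key`. -/
def rankIn (a : α) : ℕ := (F.filter fun b => key b ≤ key a).card

theorem rankIn_lt_rankIn {a b : α} (hb : b ∈ F) (h : key a < key b) :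
    rankIn F key a < rankIn F key b := by
  refine Finset.card_lt_card ((Finset.ssubset_iff_of_subset ?_).mpr ⟨b, ?_, ?_⟩)
  · exact Finset.monotone_filter_right F fun c _ hc => le_trans hc h.le
  · simp [hb]
  · simp [h]

theorem rankIn_bijOn (hkey : Set.InjOn key F) :
    Set.BijOn (rankIn F key) F (Set.Icc 1 F.card) := by
  have hmaps : Set.MapsTo (rankIn F key) F (Finset.Icc 1 F.card : Finset ℕ) := fun a ha => by
    rw [Finset.coe_Icc]
    exact ⟨Finset.card_pos.mpr ⟨a, by simpa using ha⟩, Finset.card_filter_le _ _⟩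
  have hinj : Set.InjOn (rankIn F key) F := fun a ha b hb hab => by
    refine hkey ha hb (le_antisymm ?_ ?_)
    · by_contra! h
      exact (rankIn_lt_rankIn F key ha h).ne' hab
    · by_contra! h
      exact (rankIn_lt_rankIn F key hb h).ne hab
  have hsurj := Finset.surjOn_of_injOn_of_card_le (rankIn F key) hmaps hinj (by simp)
  rw [Finset.coe_Icc] at hmaps hsurj
  exact ⟨hmaps, hinj, hsurj⟩

end Standardization

theorem exists_standardization {l : ℕ → ℕ} (hl : IsPartition l) {n i k : ℕ} {ii j d : ℕ → ℕ}
    (hii : Alternating k ii) (hjsum : ∑ t ∈ Finset.Icc 1 k, j t = n)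
    (hd : ∀ t, 1 ≤ t → t ≤ n → d t = ii (sigmaOf j t)) {S : ℕ × ℕ → ℕ}
    (hS : S ∈ ChessSet l ((i + ii 1 + 1) % 2) k j) :
    ∃ T ∈ TabSet l n i d, ∀ b, sigmaOf j (T b) = S b := by
  classical
  obtain ⟨⟨hrange, hcontent, hrow, hcol, hpar⟩, hzero⟩ := hS
  obtain ⟨F, hF⟩ := (boxes_finite hl).exists_finset_coe
  have hmemF : ∀ b, b ∈ F ↔ b ∈ boxes l := fun b => by rw [← hF, Finset.mem_coe]
  have hcount : ∀ m ≤ k, (F.filter fun b => S b ≤ m).card = ∑ r ∈ Finset.Icc 1 m, j r := by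
    intro m hm
    rw [Finset.card_eq_sum_card_fiberwise (f := S) (t := Finset.Icc 1 m)]
    · refine Finset.sum_congr rfl fun t ht => ?_
      rw [Finset.mem_Icc] at ht
      rw [← hcontent t ht.1 (ht.2.trans hm), ← Set.ncard_coe_finset]
      congr 1
      ext b
      simp only [Finset.coe_filter, Finset.mem_filter, Set.mem_ofPred_eq, hmemF]
      exact ⟨fun h => ⟨h.1.1, h.2⟩, fun h => ⟨⟨h.1, h.2.trans_le ht.2⟩, h.2⟩⟩
    · intro b hb
      simp only [Finset.coe_filter, Set.mem_ofPred_eq, hmemF] at hb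
      exact Finset.mem_coe.mpr (Finset.mem_Icc.mpr ⟨(hrange b hb.1).1, hb.2⟩)
  have hcard : F.card = n := by
    rw [← hjsum, ← hcount k le_rfl, Finset.filter_true_of_mem]
    exact fun b hb => (hrange b ((hmemF b).mp hb)).2
  let key : ℕ × ℕ → ℕ ×ₗ ℕ := fun b => toLex (S b, b.1)
  have hkey_lt : ∀ a b, key a < key b ↔ S a < S b ∨ S a = S b ∧ a.1 < b.1 := fun a b =>
    Prod.Lex.toLex_lt_toLex
  have hkey_inj : Set.InjOn key F := by
    rintro ⟨s, t⟩ ha ⟨s', t'⟩ hb hab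
    rw [hF] at ha hb
    have hab' : S (s, t) = S (s', t') ∧ s = s' := by simpa [key] using hab
    obtain ⟨hSS, rfl⟩ := hab'
    rcases lt_trichotomy t t' with h | rfl | h
    · exact absurd hSS (hrow s t t' h hb).ne
    · rfl
    · exact absurd hSS (hrow s t' t h ha).ne'
  have hbij := rankIn_bijOn F key hkey_inj
  rw [hF, hcard] at hbij
  have hlt : ∀ a b, b ∈ boxes l → key a < key b → rankIn F key a < rankIn F key b :=
    fun a b hb => rankIn_lt_rankIn F key ((hmemF b).mpr hb)
  have hsigma : ∀ b ∈ boxes l, sigmaOf j (rankIn F key b) = S b := by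
    intro b hb
    obtain ⟨h1, hk⟩ := hrange b hb
    obtain ⟨m, hm⟩ := Nat.exists_eq_add_of_le' h1
    rw [hm, sigmaOf_eq_succ_iff, ← hcount m (by omega), ← hcount (m + 1) (by omega)]
    refine ⟨Finset.card_lt_card ((Finset.ssubset_iff_of_subset ?_).mpr ⟨b, ?_, ?_⟩),
      Finset.card_le_card ?_⟩
    · refine Finset.monotone_filter_right F fun c _ hc => ((hkey_lt c b).mpr (Or.inl ?_)).le
      omega
    · simp [(hmemF b).mpr hb]
    · simp [hm]
    · refine Finset.monotone_filter_right F fun c _ hc => ?_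
      rw [← not_lt, hkey_lt] at hc
      omega
  let T : ℕ × ℕ → ℕ := fun b => if b ∈ boxes l then rankIn F key b else 0
  have hT : ∀ b ∈ boxes l, T b = rankIn F key b := fun b hb => if_pos hb
  have hT0 : ∀ b ∉ boxes l, T b = 0 := fun b hb => if_neg hb
  refine ⟨T, ⟨⟨hbij.congr fun b hb => (hT b hb).symm, ?_, ?_⟩, hT0, ?_⟩, fun b => ?_⟩
  · intro s t t' htt hb
    rw [hT _ hb, hT _ (row_mem_boxes htt.le hb)]
    exact hlt _ _ hb ((hkey_lt _ _).mpr (Or.inl (hrow s t t' htt hb)))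
  · intro s s' t hss hb
    rw [hT _ hb, hT _ (column_mem_boxes hl hss.le hb)]
    exact hlt _ _ hb ((hkey_lt _ _).mpr
      ((hcol s s' t hss hb).lt_or_eq.imp_right fun h => ⟨h, hss⟩))
  · intro b hb
    rw [hT b hb, hd _ (hbij.mapsTo hb).1 (hbij.mapsTo hb).2, hsigma b hb]
    exact (hii.eq_boxParity_iff (hrange b hb).1 (hrange b hb).2 _ _ _).mpr (hpar b hb)
  · by_cases hb : b ∈ boxes l
    · rw [hT b hb, hsigma b hb]
    · rw [hT0 b hb, hzero b hb, sigmaOf_zero]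

/-! Statement 2: the map Σ (replacing each label t by σ(t)) sends
`Tab^{(i)}(λ; d)` into `Chess^{(i*)}_j(λ)` and is surjective onto it. -/

theorem sigma_map_into_chess_and_surjective
    (l : ℕ → ℕ) (hl : IsPartition l) (n : ℕ) (hn : psize l = n)
    (i : ℕ) (hi : i ≤ 1) (k : ℕ) (ii : ℕ → ℕ) (hii : Alternating k ii)
    (j : ℕ → ℕ) (hjsum : ∑ t ∈ Finset.Icc 1 k, j t = n)
    (d : ℕ → ℕ) (hd : ∀ t, 1 ≤ t → t ≤ n → d t = ii (sigmaOf j t)) :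
    (∀ T ∈ TabSet l n i d,
        (fun b => sigmaOf j (T b)) ∈ ChessSet l ((i + ii 1 + 1) % 2) k j) ∧
    (∀ S ∈ ChessSet l ((i + ii 1 + 1) % 2) k j,
        ∃ T ∈ TabSet l n i d, ∀ b, sigmaOf j (T b) = S b) := by
  exact ⟨fun _ hT => sigmaOf_comp_mem_chessSet hii hjsum hd hT,
    fun _ hS => exists_standardization hl hii hjsum hd hS⟩
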